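/- arXiv:1912.00829 — 2 statements merged into one kernel-verified Lean document; each statement's English description precedes it below -/
import Mathlib

section
/- For all Δ, κ > 0 and all z ∈ ℝ: Σ_{β ∈ {−1/2, 1/2}} [φ^{Δ/√2, √2·κ}_β(z)]² = c(Δ,κ) · φ^{Δ,κ}_1(2z), where c(Δ,κ) = Σ_{m∈ℤ} exp(−2π m² (κ² + 1/Δ²)). -/
open Real

/-- Unnormalized approximate GKP comb wavefunction with widths `Δ, κ` and peak offset `ν`:
`φ^{Δ,κ}_ν(x) = Σ_{s∈ℤ} exp(−π κ² (2s+ν)²/2) · exp(−(x−(2s+ν)√π)²/(2Δ²))`. -/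
noncomputable def gkp (Δ κ ν : ℝ) (x : ℝ) : ℝ :=
  ∑' s : ℤ, Real.exp (-(Real.pi * κ ^ 2 * (2 * (s : ℝ) + ν) ^ 2 / 2)) *
    Real.exp (-((x - (2 * (s : ℝ) + ν) * Real.sqrt Real.pi) ^ 2 / (2 * Δ ^ 2)))

/-- The z-independent proportionality constant . -/
noncomputable def gkpConst (Δ κ : ℝ) : ℝ :=
  ∑' m : ℤ, Real.exp (-(2 * Real.pi * (m : ℝ) ^ 2 * (κ ^ 2 + 1 / Δ ^ 2)))

lemma summable_exp_neg_pi_mul_sq {t : ℝ} (ht : 0 < t) :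
    Summable fun n : ℤ ↦ Real.exp (-(Real.pi * t * (n : ℝ) ^ 2)) := by
  have h := ((summable_jacobiTheta₂_term_iff 0 (Complex.I * t)).2 (by simpa using ht)).norm
  refine h.congr fun n ↦ ?_
  rw [norm_jacobiTheta₂_term]
  simp
  ring

lemma summable_gkp_term (Δ ν x : ℝ) {κ : ℝ} (hκ : 0 < κ) :
    Summable fun s : ℤ ↦ Real.exp (-(Real.pi * κ ^ 2 * (2 * (s : ℝ) + ν) ^ 2 / 2)) *
      Real.exp (-((x - (2 * (s : ℝ) + ν) * Real.sqrt Real.pi) ^ 2 / (2 * Δ ^ 2))) := by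
  refine Summable.of_nonneg_of_le (fun s ↦ by positivity) (fun s ↦ ?_)
    ((summable_exp_neg_pi_mul_sq (pow_pos hκ 2)).mul_left
      (Real.exp (Real.pi * κ ^ 2 * ν ^ 2 / 2)))
  refine (mul_le_of_le_one_right (Real.exp_pos _).le ?_).trans ?_
  · exact Real.exp_le_one_iff.2 (neg_nonpos.2 (by positivity))
  · rw [← Real.exp_add, Real.exp_le_exp]
    have : 0 ≤ Real.pi * κ ^ 2 * ((s : ℝ) + ν) ^ 2 := by positivity
    linarith

lemma summable_gkpConst_term {Δ κ : ℝ} (hκ : 0 < κ) :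
    Summable fun m : ℤ ↦ Real.exp (-(2 * Real.pi * (m : ℝ) ^ 2 * (κ ^ 2 + 1 / Δ ^ 2))) := by
  refine (summable_exp_neg_pi_mul_sq (t := 2 * (κ ^ 2 + 1 / Δ ^ 2)) (by positivity)).congr
    fun m ↦ ?_
  ring_nf

/-- A sum over pairs of integers, split by the parity of the sum of the two entries. -/
lemma tsum_int_prod_eq_add {f : ℤ × ℤ → ℝ} (hf : Summable f) :
    ∑' p, f p = ∑' p : ℤ × ℤ, f (p.1 - p.2, p.1 + p.2 - 1) +
      ∑' p : ℤ × ℤ, f (p.1 - p.2, p.1 + p.2) := by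
  let g : ℤ × ℤ → ℤ × ℤ := fun p ↦ (p.1 - p.2, p.1 + p.2 - 1)
  let h : ℤ × ℤ → ℤ × ℤ := fun p ↦ (p.1 - p.2, p.1 + p.2)
  have hg : Function.Injective g := by
    rintro ⟨a, b⟩ ⟨c, d⟩ H
    simp only [g, Prod.mk.injEq] at H ⊢
    lia
  have hh : Function.Injective h := by
    rintro ⟨a, b⟩ ⟨c, d⟩ H
    simp only [h, Prod.mk.injEq] at H ⊢
    lia
  have hc : IsCompl (Set.range g) (Set.range h) := by
    refine ⟨Set.disjoint_left.2 ?_, codisjoint_iff_le_sup.2 ?_⟩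
    · rintro _ ⟨⟨a, b⟩, rfl⟩ ⟨⟨c, d⟩, H⟩
      simp only [g, h, Prod.mk.injEq] at H
      lia
    · rintro ⟨m, n⟩ -
      rcases Int.even_or_odd' (n + m) with ⟨k, hk | hk⟩
      · exact Or.inr ⟨(k, n - k), by simp only [h, Prod.mk.injEq]; lia⟩
      · exact Or.inl ⟨(k + 1, n - k), by simp only [g, Prod.mk.injEq]; lia⟩
  exact (((hg.hasSum_range_iff).2 (hf.comp_injective hg).hasSum).add_isCompl hc
    ((hh.hasSum_range_iff).2 (hf.comp_injective hh).hasSum)).tsum_eq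

lemma gkp_sq_eq_tsum (Δ β z : ℝ) {κ : ℝ} (hκ : 0 < κ) :
    gkp (Δ / Real.sqrt 2) (Real.sqrt 2 * κ) β z ^ 2 = ∑' p : ℤ × ℤ,
      Real.exp (-(2 * Real.pi * ((p.1 - p.2 : ℤ) : ℝ) ^ 2 * (κ ^ 2 + 1 / Δ ^ 2))) *
      (Real.exp (-(Real.pi * κ ^ 2 * (2 * ((p.1 + p.2 : ℤ) : ℝ) + 2 * β) ^ 2 / 2)) *
      Real.exp (-((2 * z - (2 * ((p.1 + p.2 : ℤ) : ℝ) + 2 * β) * Real.sqrt Real.pi) ^ 2 /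
        (2 * Δ ^ 2)))) := by
  have hs := (summable_gkp_term (Δ / Real.sqrt 2) β z (κ := Real.sqrt 2 * κ) (by positivity)).norm
  rw [sq, gkp, tsum_mul_tsum_of_summable_norm hs hs]
  refine tsum_congr fun p ↦ ?_
  simp only [← Real.exp_add]
  congr 1
  have h2 : Real.sqrt 2 ^ 2 = 2 := Real.sq_sqrt (by norm_num)
  have hpi : Real.sqrt Real.pi ^ 2 = Real.pi := Real.sq_sqrt Real.pi_pos.le
  rw [div_pow, mul_pow, h2, show 2 * (Δ ^ 2 / 2) = Δ ^ 2 by ring]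
  push_cast
  linear_combination (-2 * ((p.1 : ℝ) - p.2) ^ 2 / Δ ^ 2) * hpi

/-- Exact re-indexing identity (odd-peak part) underlying the likelihood calculation
of Theorem 2: . -/
theorem gkp_reindex_odd (Δ κ : ℝ) (hΔ : 0 < Δ) (hκ : 0 < κ) (z : ℝ) :
    ∑ β ∈ ({-1/2, 1/2} : Finset ℝ), (gkp (Δ / Real.sqrt 2) (Real.sqrt 2 * κ) β z) ^ 2 =
      gkpConst Δ κ * gkp Δ κ 1 (2 * z) := by
  have hA := (summable_gkp_term Δ 1 (2 * z) hκ).norm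
  have hC := (summable_gkpConst_term (Δ := Δ) hκ).norm
  rw [Finset.sum_pair (by norm_num), gkp_sq_eq_tsum Δ _ z hκ, gkp_sq_eq_tsum Δ _ z hκ,
    gkpConst, gkp, tsum_mul_tsum_of_summable_norm hC hA,
    tsum_int_prod_eq_add (summable_mul_of_summable_norm hC hA)]
  congr 1 <;> refine tsum_congr fun p ↦ ?_ <;> push_cast <;> ring_nf
end

section
/- Fix an integer M ≥ 1 and Δ, σ₀ > 0, let B be the M×M matrix with entries B_{αβ} = 2^{α+β} · Σ_{h=max(α,β)}^{M} 4^{−h}, and let a ∈ ℝ^M have entries a_k = 2^{k−M−1}. Then σ₀² · Σ_{k=1}^{M} a_k² − (σ₀⁴/Δ²) · Σ_{α,β=1}^{M} a_α a_β B_{αβ} = (σ₀²/3) · [ (1 − 4^{−M}) + (σ₀/Δ)² · (4/9) · (4^{−2M} + 3(1+2M)·4^{−M} − 4) ]. -/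
open Real Finset

/-- A quadratic form whose kernel is a tail sum of `w` is a `w`-weighted sum of squared
partial sums. -/
theorem sum_mul_sum_Icc_max {R : Type*} [CommSemiring R] (f w : ℕ → R) (m M : ℕ) :
    ∑ α ∈ Finset.Icc m M, ∑ β ∈ Finset.Icc m M,
        f α * f β * ∑ h ∈ Finset.Icc (max α β) M, w h =
      ∑ h ∈ Finset.Icc m M, w h * (∑ α ∈ Finset.Icc m h, f α) ^ 2 := by
  simp_rw [sq, Finset.sum_mul_sum, Finset.mul_sum]
  symm
  rw [Finset.sum_comm' (t' := Finset.Icc m M) (s' := fun α => Finset.Icc α M)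
    (by intro h α; simp only [Finset.mem_Icc]; omega)]
  refine Finset.sum_congr rfl fun α hα => ?_
  rw [Finset.sum_comm' (t' := Finset.Icc m M) (s' := fun β => Finset.Icc (max α β) M)
    (by intro h β; simp only [Finset.mem_Icc] at hα ⊢; omega)]
  exact Finset.sum_congr rfl fun β _ => Finset.sum_congr rfl fun h _ => mul_comm _ _

theorem sum_Icc_one_four_pow (n : ℕ) :
    ∑ k ∈ Finset.Icc 1 n, (4 : ℝ) ^ k = 4 * (4 ^ n - 1) / 3 := by
  induction n with
  | zero => simp
  | succ n ih => rw [Finset.sum_Icc_succ_top (by omega), ih]; ring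

theorem sum_Icc_one_four_pow_sub_one_sq_div (n : ℕ) :
    ∑ h ∈ Finset.Icc 1 n, ((4 : ℝ) ^ h)⁻¹ * (4 ^ h - 1) ^ 2 =
      (4 * 4 ^ n - 3 - 6 * n - ((4 : ℝ) ^ n)⁻¹) / 3 := by
  induction n with
  | zero => norm_num
  | succ n ih =>
    rw [Finset.sum_Icc_succ_top (by omega), ih]
    push_cast
    field_simp
    ring

/-- Closed form `V_q(M)` of the variance of the memory-assisted decoder's estimate:
`σ₀² Σ_k a_k² − (σ₀⁴/Δ²) a^T B a
  = (σ₀²/3)[(1 − 4^{−M}) + (σ₀/Δ)²(4/9)(4^{−2M} + 3(1+2M)4^{−M} − 4)]`,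
with `a_k = 2^{k−M−1}` and `B_{αβ} = 2^{α+β}·Σ_{h=max(α,β)}^{M} 4^{−h}`. -/
theorem variance_closed_form (M : ℕ) (hM : 1 ≤ M) (Δ σ₀ : ℝ)
    (hΔ : 0 < Δ) (hσ : 0 < σ₀)
    (B : ℕ → ℕ → ℝ)
    (hB : ∀ α β, B α β =
      2 ^ (α + β) * ∑ h ∈ Finset.Icc (max α β) M, (4 : ℝ) ^ (-(h : ℤ)))
    (a : ℕ → ℝ) (ha : ∀ k, a k = (2 : ℝ) ^ ((k : ℤ) - (M : ℤ) - 1)) :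
    σ₀ ^ 2 * (∑ k ∈ Finset.Icc 1 M, a k ^ 2) -
        (σ₀ ^ 4 / Δ ^ 2) *
          ∑ α ∈ Finset.Icc 1 M, ∑ β ∈ Finset.Icc 1 M, a α * a β * B α β =
      (σ₀ ^ 2 / 3) *
        ((1 - (4 : ℝ) ^ (-(M : ℤ))) +
          (σ₀ / Δ) ^ 2 * (4 / 9) *
            ((4 : ℝ) ^ (-2 * (M : ℤ)) + 3 * (1 + 2 * (M : ℝ)) * (4 : ℝ) ^ (-(M : ℤ)) - 4)) := by
  have h_weight (k : ℕ) : a k = 2 ^ k * (2 * 2 ^ M)⁻¹ := by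
    rw [ha, sub_sub, zpow_sub₀ two_ne_zero, zpow_add₀ two_ne_zero, zpow_natCast, zpow_natCast,
      zpow_one, div_eq_mul_inv, mul_comm (2 ^ M : ℝ)]
  have h_four (k : ℕ) : (2 : ℝ) ^ k * 2 ^ k = 4 ^ k := by
    rw [← mul_pow]; norm_num
  have h_diag : ∑ k ∈ Finset.Icc 1 M, a k ^ 2 = (1 - ((4 : ℝ) ^ M)⁻¹) / 3 := by
    have h_term (k : ℕ) : a k ^ 2 = 4 ^ k * (4 * 4 ^ M)⁻¹ := by
      rw [h_weight, ← h_four, ← h_four, mul_inv, mul_inv, mul_inv]; ring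
    simp_rw [h_term]
    rw [← Finset.sum_mul, sum_Icc_one_four_pow]
    field_simp
  have h_quad : ∑ α ∈ Finset.Icc 1 M, ∑ β ∈ Finset.Icc 1 M, a α * a β * B α β =
      4 / 27 * ((4 : ℝ) ^ M)⁻¹ * (4 * 4 ^ M - 3 - 6 * M - ((4 : ℝ) ^ M)⁻¹) := by
    have h_term (α β : ℕ) : a α * a β * B α β =
        (4 * 4 ^ M)⁻¹ * (4 ^ α * 4 ^ β *
          ∑ h ∈ Finset.Icc (max α β) M, ((4 : ℝ) ^ h)⁻¹) := by
      simp_rw [hB, h_weight, zpow_neg, zpow_natCast, pow_add]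
      rw [← h_four α, ← h_four β, ← h_four M, mul_inv, mul_inv, mul_inv]
      ring
    simp_rw [h_term, ← Finset.mul_sum]
    rw [sum_mul_sum_Icc_max (fun k => (4 : ℝ) ^ k) (fun h => ((4 : ℝ) ^ h)⁻¹)]
    have h_sq (h : ℕ) : ((4 : ℝ) ^ h)⁻¹ * (∑ k ∈ Finset.Icc 1 h, (4 : ℝ) ^ k) ^ 2 =
        16 / 9 * (((4 : ℝ) ^ h)⁻¹ * (4 ^ h - 1) ^ 2) := by
      rw [sum_Icc_one_four_pow]; ring
    simp_rw [h_sq]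
    rw [← Finset.mul_sum, sum_Icc_one_four_pow_sub_one_sq_div, mul_inv]
    ring
  have h_double : (4 : ℝ) ^ (-2 * (M : ℤ)) = (((4 : ℝ) ^ M)⁻¹) ^ 2 := by
    rw [mul_comm, zpow_mul, zpow_natCast, zpow_neg, inv_pow]
    norm_cast
  rw [h_diag, h_quad, h_double, zpow_neg, zpow_natCast]
  field_simp
  ring
end
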